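/- arXiv:1912.00910 — 3 statements merged into one kernel-verified Lean document; each statement's English description precedes it below -/
import Mathlib

section
/- Let H be a complex Hilbert space and A, B ∈ B⁺(H). For every ε > 0 the operators A + εI and B + εI are invertible, and the operator P_ε := ((A+εI)^{-1} + (B+εI)^{-1})^{-1} belongs to B⁺(H) and is nondecreasing in ε. There exists A:B ∈ B⁺(H) (the parallel sum) such that P_ε → A:B in the strong operator topology as ε ↓ 0. Moreover A:B ≤ A, A:B ≤ B, A:B = B:A, and if A₁ ≤ A₂ in B⁺(H) then A₁:B ≤ A₂:B. -/
open ContinuousLinearMap Filter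

variable {H : Type*} [NormedAddCommGroup H] [InnerProductSpace ℂ H] [CompleteSpace H]

/-- The regularized parallel sum `((A + εI)⁻¹ + (B + εI)⁻¹)⁻¹` (via `Ring.inverse`, which is
the genuine inverse whenever the operators are invertible). -/
noncomputable def presum (A B : H →L[ℂ] H) (ε : ℝ) : H →L[ℂ] H :=
  Ring.inverse (Ring.inverse (A + (ε : ℂ) • 1) + Ring.inverse (B + (ε : ℂ) • 1))

/-- `P` is the parallel sum `A : B`: the strong limit, as `ε ↓ 0`, of
`((A + εI)⁻¹ + (B + εI)⁻¹)⁻¹`. -/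
def IsParallelSum (A B P : H →L[ℂ] H) : Prop :=
  ∀ x : H, Tendsto (fun ε : ℝ => presum A B ε x) (nhdsWithin 0 (Set.Ioi 0)) (nhds (P x))

open scoped InnerProductSpace in
theorem ContinuousLinearMap.IsPositive.norm_apply_sq_le {T : H →L[ℂ] H} (hT : T.IsPositive)
    (x : H) : ‖T x‖ ^ 2 ≤ ‖T‖ * (⟪T x, x⟫_ℂ).re := by
  have h0 : 0 ≤ T := (nonneg_iff_isPositive T).2 hT
  obtain ⟨S, hS, hSS⟩ : ∃ S : H →L[ℂ] H, star S = S ∧ S * S = T :=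
    ⟨CFC.sqrt T, (IsSelfAdjoint.of_nonneg (CFC.sqrt_nonneg T)).star_eq,
      CFC.sqrt_mul_sqrt_self T h0⟩
  have hnorm : ‖T‖ = ‖S‖ ^ 2 := by
    rw [← hSS, sq, ← CStarRing.norm_star_mul_self, hS]
  have hinner : (⟪T x, x⟫_ℂ).re = ‖S x‖ ^ 2 := by
    rw [← hSS, mul_apply_eq_comp, ← adjoint_inner_right, ← star_eq_adjoint, hS]
    exact inner_self_eq_norm_sq (𝕜 := ℂ) (S x)
  rw [hnorm, hinner, ← mul_pow, ← hSS]
  exact pow_le_pow_left₀ (norm_nonneg _) (S.le_opNorm (S x)) 2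

open scoped ComplexOrder in
/-- The Loewner order is closed under limits in the strong operator topology. -/
theorem ContinuousLinearMap.le_of_tendsto_apply {E : Type*} [NormedAddCommGroup E] [InnerProductSpace ℂ E]
    {ι : Type*} {l : Filter ι} [l.NeBot] {F G : ι → E →L[ℂ] E} {P Q : E →L[ℂ] E}
    (hF : ∀ x, Tendsto (F · x) l (nhds (P x))) (hG : ∀ x, Tendsto (G · x) l (nhds (Q x)))
    (h : ∀ᶠ i in l, F i ≤ G i) : P ≤ Q := by
  rw [le_def, isPositive_iff_complex]
  intro x
  have hlim : Tendsto (fun i => inner ℂ ((G i - F i) x) x) l (nhds (inner ℂ ((Q - P) x) x)) :=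
    ((hG x).sub (hF x)).inner tendsto_const_nhds
  have hnonneg : 0 ≤ inner ℂ ((Q - P) x) x :=
    ge_of_tendsto hlim (h.mono fun i hi => IsPositive.inner_nonneg_left hi x)
  obtain ⟨hre, him⟩ := Complex.nonneg_iff.1 hnonneg
  exact ⟨Complex.ext rfl him, hre⟩

/-- A nonnegative nondecreasing family of operators converges strongly at the left endpoint. -/
theorem ContinuousLinearMap.exists_tendsto_apply_of_monotoneOn {F : ℝ → H →L[ℂ] H} {a : ℝ}
    (hmono : MonotoneOn F (Set.Ioi a)) (hnonneg : ∀ t, a < t → 0 ≤ F t) :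
    ∃ P : H →L[ℂ] H, ∀ x, Tendsto (F · x) (nhdsWithin a (Set.Ioi a)) (nhds (P x)) := by
  have key : ∀ x, ∃ y, Tendsto (F · x) (nhdsWithin a (Set.Ioi a)) (nhds y) := by
    intro x
    set q : ℝ → ℝ := fun t => (inner ℂ (F t x) x).re with hq
    have hqmono : MonotoneOn q (Set.Ioi a) := by
      intro s hs t ht hst
      have := IsPositive.re_inner_nonneg_left (hmono hs ht hst) x
      simpa [hq, inner_sub_left] using this
    have hqbdd : BddBelow (q '' Set.Ioi a) := by
      refine ⟨0, ?_⟩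
      rintro _ ⟨t, ht, rfl⟩
      exact ((nonneg_iff_isPositive _).1 (hnonneg t ht)).re_inner_nonneg_left x
    have hqlim := hqmono.tendsto_nhdsGT hqbdd
    set C := ‖F (a + 1)‖
    have hbound : ∀ s t, a < s → s ≤ t → t ≤ a + 1 → ‖F t x - F s x‖ ^ 2 ≤ C * (q t - q s) := by
      intro s t hs hst ht
      have hle : F s ≤ F t := hmono hs (hs.trans_le hst) hst
      have hle' : F t - F s ≤ F (a + 1) :=
        (sub_le_self _ (hnonneg s hs)).trans
          (hmono (hs.trans_le hst) (Set.mem_Ioi.2 (by linarith)) ht)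
      have hnorm : ‖F t - F s‖ ≤ C :=
        CStarAlgebra.norm_le_norm_of_nonneg_of_le (sub_nonneg.2 hle) hle'
      have h1 := IsPositive.norm_apply_sq_le hle x
      have h2 : (inner ℂ ((F t - F s) x) x).re = q t - q s := by
        simp [hq]
      rw [h2] at h1
      exact h1.trans (mul_le_mul_of_nonneg_right hnorm
        (sub_nonneg.2 (hqmono hs (hs.trans_le hst) hst)))
    have hbound' : ∀ s t, s ∈ Set.Ioc a (a + 1) → t ∈ Set.Ioc a (a + 1) →
        ‖F s x - F t x‖ ^ 2 ≤ C * |q s - q t| := by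
      intro s t hs ht
      rcases le_total s t with hst | hst
      · rw [norm_sub_rev, abs_sub_comm]
        exact (hbound s t hs.1 hst ht.2).trans (by gcongr; exact le_abs_self _)
      · exact (hbound t s ht.1 hst hs.2).trans (by gcongr; exact le_abs_self _)
    have hcauchy : Tendsto (fun p : ℝ × ℝ => ‖F p.1 x - F p.2 x‖ ^ 2)
        (nhdsWithin a (Set.Ioi a) ×ˢ nhdsWithin a (Set.Ioi a)) (nhds 0) := by
      have hlim : Tendsto (fun p : ℝ × ℝ => C * |q p.1 - q p.2|)
          (nhdsWithin a (Set.Ioi a) ×ˢ nhdsWithin a (Set.Ioi a)) (nhds 0) := by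
        simpa using ((hqlim.comp tendsto_fst).sub (hqlim.comp tendsto_snd)).abs.const_mul C
      have hmem : Set.Ioc a (a + 1) ∈ nhdsWithin a (Set.Ioi a) := Ioc_mem_nhdsGT (by linarith)
      refine squeeze_zero' (Eventually.of_forall fun p => by positivity) ?_ hlim
      filter_upwards [prod_mem_prod hmem hmem] with p hp
      exact hbound' p.1 p.2 hp.1 hp.2
    apply cauchy_map_iff_exists_tendsto.1
    rw [cauchy_map_iff', Metric.uniformity_eq_comap_nhds_zero, tendsto_comap_iff]
    have := hcauchy.sqrt
    simpa [Function.comp_def, dist_eq_norm] using this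
  choose f hf using key
  exact ⟨continuousLinearMapOfTendsto F (tendsto_pi_nhds.2 hf), hf⟩

theorem isStrictlyPositive_add_smul_one {A : H →L[ℂ] H} (hA : 0 ≤ A) {ε : ℝ} (hε : 0 < ε) :
    IsStrictlyPositive (A + (ε : ℂ) • (1 : H →L[ℂ] H)) := by
  refine IsStrictlyPositive.nonneg_add hA ⟨?_, ?_⟩
  · rw [nonneg_iff_isPositive]
    exact isPositive_one.smul_of_nonneg (by exact_mod_cast hε.le)
  · rw [← Algebra.algebraMap_eq_smul_one]
    exact (IsUnit.mk0 (ε : ℂ) (by exact_mod_cast hε.ne')).map _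

theorem add_smul_one_le_add_smul_one {A₁ A₂ : H →L[ℂ] H} (h : A₁ ≤ A₂) {ε₁ ε₂ : ℝ}
    (hε : ε₁ ≤ ε₂) : A₁ + (ε₁ : ℂ) • (1 : H →L[ℂ] H) ≤ A₂ + (ε₂ : ℂ) • (1 : H →L[ℂ] H) := by
  refine add_le_add h ((le_def _ _).2 ?_)
  rw [← sub_smul, ← Complex.ofReal_sub]
  exact isPositive_one.smul_of_nonneg (by exact_mod_cast sub_nonneg.2 hε)

theorem presum_nonneg {A B : H →L[ℂ] H} (hA : 0 ≤ A) (hB : 0 ≤ B) {ε : ℝ} (hε : 0 < ε) :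
    0 ≤ presum A B ε :=
  ((isStrictlyPositive_add_smul_one hA hε).ringInverse.add_nonneg
    (isStrictlyPositive_add_smul_one hB hε).ringInverse.nonneg).ringInverse.nonneg

theorem presum_mono {A₁ A₂ B : H →L[ℂ] H} (hA : 0 ≤ A₁) (hB : 0 ≤ B) (h : A₁ ≤ A₂) {ε₁ ε₂ : ℝ}
    (hε₁ : 0 < ε₁) (hε : ε₁ ≤ ε₂) : presum A₁ B ε₁ ≤ presum A₂ B ε₂ := by
  have hε₂ := hε₁.trans_le hε
  refine CStarAlgebra.ringInverse_le_ringInverse (add_le_add ?_ ?_)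
    ((isStrictlyPositive_add_smul_one (hA.trans h) hε₂).ringInverse.add_nonneg
      (isStrictlyPositive_add_smul_one hB hε₂).ringInverse.nonneg)
  · exact CStarAlgebra.ringInverse_le_ringInverse (add_smul_one_le_add_smul_one h hε)
      (isStrictlyPositive_add_smul_one hA hε₁)
  · exact CStarAlgebra.ringInverse_le_ringInverse (add_smul_one_le_add_smul_one le_rfl hε)
      (isStrictlyPositive_add_smul_one hB hε₁)

theorem presum_le_left {A B : H →L[ℂ] H} (hA : 0 ≤ A) (hB : 0 ≤ B) {ε : ℝ} (hε : 0 < ε) :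
    presum A B ε ≤ A + (ε : ℂ) • (1 : H →L[ℂ] H) := by
  have hA' := isStrictlyPositive_add_smul_one hA hε
  calc presum A B ε ≤ Ring.inverse (Ring.inverse (A + (ε : ℂ) • (1 : H →L[ℂ] H))) :=
        CStarAlgebra.ringInverse_le_ringInverse (le_add_of_nonneg_right
          (isStrictlyPositive_add_smul_one hB hε).ringInverse.nonneg) hA'.ringInverse
    _ = A + (ε : ℂ) • (1 : H →L[ℂ] H) := by
        obtain ⟨u, hu⟩ := hA'.isUnit
        rw [← hu, Ring.inverse_unit, Ring.inverse_unit, inv_inv]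

theorem IsParallelSum.symm {E : Type*} [NormedAddCommGroup E] [InnerProductSpace ℂ E]
    {A B P : E →L[ℂ] E} (h : IsParallelSum A B P) :
    IsParallelSum B A P := by
  intro x
  simp only [presum, add_comm (Ring.inverse (B + _))]
  exact h x

theorem IsParallelSum.le_left {A B P : H →L[ℂ] H} (hA : 0 ≤ A) (hB : 0 ≤ B)
    (h : IsParallelSum A B P) : P ≤ A := by
  refine le_of_tendsto_apply h (G := fun ε : ℝ => A + (ε : ℂ) • (1 : H →L[ℂ] H)) (fun x => ?_)
    (eventually_nhdsWithin_of_forall fun ε hε => presum_le_left hA hB hε)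
  have hcont : Continuous fun ε : ℝ => (A + (ε : ℂ) • (1 : H →L[ℂ] H)) x := by
    simp only [add_apply, smul_apply, one_apply_eq_self]
    fun_prop
  simpa using (hcont.tendsto 0).mono_left nhdsWithin_le_nhds

theorem IsParallelSum.mono {A₁ A₂ B P₁ P₂ : H →L[ℂ] H} (hA : 0 ≤ A₁) (hB : 0 ≤ B) (h : A₁ ≤ A₂)
    (h₁ : IsParallelSum A₁ B P₁) (h₂ : IsParallelSum A₂ B P₂) : P₁ ≤ P₂ :=
  le_of_tendsto_apply h₁ h₂
    (eventually_nhdsWithin_of_forall fun _ hε => presum_mono hA hB h hε le_rfl)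

theorem IsParallelSum.nonneg {A B P : H →L[ℂ] H} (hA : 0 ≤ A) (hB : 0 ≤ B)
    (h : IsParallelSum A B P) : 0 ≤ P :=
  le_of_tendsto_apply (F := 0) (fun _ => tendsto_const_nhds) h
    (eventually_nhdsWithin_of_forall fun _ hε => presum_nonneg hA hB hε)

theorem exists_isParallelSum {A B : H →L[ℂ] H} (hA : 0 ≤ A) (hB : 0 ≤ B) :
    ∃ P, IsParallelSum A B P :=
  exists_tendsto_apply_of_monotoneOn
    (fun _ h₁ _ _ h => presum_mono hA hB le_rfl h₁ h) fun _ hε => presum_nonneg hA hB hε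

/-- Existence and basic properties of the parallel sum of `A, B ∈ B⁺(H)`:
`A + εI`, `B + εI` are invertible for `ε > 0`; the regularizations are nonnegative and
nondecreasing in `ε`; they converge strongly as `ε ↓ 0` to an operator `A : B ∈ B⁺(H)`
with `A : B ≤ A`, `A : B ≤ B`, `A : B = B : A`, and `A₁ ≤ A₂ → A₁ : B ≤ A₂ : B`. -/
theorem exists_parallelSum (A B : H →L[ℂ] H) (hA : A.IsPositive) (hB : B.IsPositive) :
    (∀ ε : ℝ, 0 < ε → IsUnit (A + (ε : ℂ) • 1) ∧ IsUnit (B + (ε : ℂ) • 1)) ∧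
    (∀ ε : ℝ, 0 < ε → (presum A B ε).IsPositive) ∧
    (∀ ε₁ ε₂ : ℝ, 0 < ε₁ → ε₁ ≤ ε₂ → (presum A B ε₂ - presum A B ε₁).IsPositive) ∧
    ∃ P : H →L[ℂ] H, P.IsPositive ∧ IsParallelSum A B P ∧
      (A - P).IsPositive ∧ (B - P).IsPositive ∧ IsParallelSum B A P ∧
      ∀ A₁ A₂ P₁ P₂ : H →L[ℂ] H, A₁.IsPositive → A₂.IsPositive → (A₂ - A₁).IsPositive →
        IsParallelSum A₁ B P₁ → IsParallelSum A₂ B P₂ → (P₂ - P₁).IsPositive := by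
  have hA' := (nonneg_iff_isPositive A).2 hA
  have hB' := (nonneg_iff_isPositive B).2 hB
  obtain ⟨P, hP⟩ := exists_isParallelSum hA' hB'
  refine ⟨fun ε hε => ⟨(isStrictlyPositive_add_smul_one hA' hε).isUnit,
    (isStrictlyPositive_add_smul_one hB' hε).isUnit⟩,
    fun ε hε => (nonneg_iff_isPositive _).1 (presum_nonneg hA' hB' hε),
    fun ε₁ ε₂ hε₁ hε => presum_mono hA' hB' le_rfl hε₁ hε,
    P, (nonneg_iff_isPositive P).1 (hP.nonneg hA' hB'), hP, hP.le_left hA' hB',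
    hP.symm.le_left hB' hA', hP.symm, fun A₁ A₂ P₁ P₂ hA₁ _ h h₁ h₂ => ?_⟩
  exact h₁.mono ((nonneg_iff_isPositive A₁).2 hA₁) hB' h h₂
end

section
/- Let H be a complex Hilbert space and let A, B ∈ B⁺(H) be invertible. Set W := (I+A)^{-1} + (I+B)^{-1} − I; then W is selfadjoint with −I ≤ W ≤ I and I + W is invertible, so c₀(A,B) := (I − W)(I + W)^{-1} is a well-defined element of B⁺(H). Then the following chain of inequalities holds: 2(A^{-1} + B^{-1})^{-1} ≤ c₀(A,B) ≤ (A+B)/2. Moreover, equality holds in either inequality (or between the two outer terms) if and only if A = B. -/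
open ContinuousLinearMap

variable {H : Type*} [NormedAddCommGroup H] [InnerProductSpace ℂ H] [CompleteSpace H]

section Algebra

variable {R : Type*} [Ring R]

/-- The arithmetic mean `(a + b) / 2`. -/
noncomputable def arithMean [Algebra ℂ R] (a b : R) : R := (2 : ℂ)⁻¹ • (a + b)

/-- The harmonic mean `2 (a⁻¹ + b⁻¹)⁻¹`. -/
noncomputable def harmMean [Algebra ℂ R] (a b : R) : R :=
  (2 : ℂ) • Ring.inverse (Ring.inverse a + Ring.inverse b)

/-- The operator `W = (1 + a)⁻¹ + (1 + b)⁻¹ - 1`, whose Cayley transform is the mean `c₀`. -/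
noncomputable def cayleySum (a b : R) : R := Ring.inverse (1 + a) + Ring.inverse (1 + b) - 1

/-- The Cayley-transform mean `c₀ = (1 - W) (1 + W)⁻¹`. -/
noncomputable def cayleyMean (a b : R) : R :=
  (1 - cayleySum a b) * Ring.inverse (1 + cayleySum a b)

lemma one_add_cayleySum (a b : R) :
    1 + cayleySum a b = Ring.inverse (1 + a) + Ring.inverse (1 + b) := by
  unfold cayleySum; abel

lemma ringInverse_eq_of_mul_eq_one {x y : R} (hx : IsUnit x) (h : x * y = 1) :
    Ring.inverse x = y := by
  rw [← mul_one (Ring.inverse x), ← h, Ring.inverse_mul_cancel_left x y hx]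

lemma ringInverse_smul [Algebra ℂ R] {c : ℂ} (hc : c ≠ 0) {x : R} (hx : IsUnit x) :
    Ring.inverse (c • x) = c⁻¹ • Ring.inverse x := by
  refine ringInverse_eq_of_mul_eq_one (hx.smul (Units.mk0 c hc)) ?_
  rw [smul_mul_smul_comm, Ring.mul_inverse_cancel x hx, mul_inv_cancel₀ hc, one_smul]

lemma ringInverse_one_add_ringInverse {a : R} (ha : IsUnit a) (h₁ : IsUnit (1 + a))
    (h₂ : IsUnit (1 + Ring.inverse a)) :
    Ring.inverse (1 + Ring.inverse a) = 1 - Ring.inverse (1 + a) := by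
  refine ringInverse_eq_of_mul_eq_one h₂ ?_
  have h := Ring.mul_inverse_cancel (1 + a) h₁
  generalize Ring.inverse (1 + a) = x at h ⊢
  have hx : 1 - x = a * x := by rw [← h]; noncomm_ring
  calc (1 + Ring.inverse a) * (1 - x) = (1 - x) + Ring.inverse a * (1 - x) := by noncomm_ring
    _ = (1 - x) + x := by
      congr 1
      rw [hx, Ring.inverse_mul_cancel_left a x ha]
    _ = 1 := sub_add_cancel 1 x

lemma ringInverse_ringInverse_add {p q : R} (hp : IsUnit p) (hq : IsUnit q)
    (hpq : IsUnit (p + q)) :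
    Ring.inverse (Ring.inverse p + Ring.inverse q) = p * Ring.inverse (p + q) * q := by
  have h : Ring.inverse p + Ring.inverse q = Ring.inverse q * ((p + q) * Ring.inverse p) := by
    rw [add_mul, mul_add, Ring.mul_inverse_cancel p hp, mul_one,
      Ring.inverse_mul_cancel_left _ _ hq, add_comm]
  rw [h, Ring.inverse_mul (Or.inl hq.ringInverse), Ring.inverse_mul (Or.inl hpq),
    Ring.inverse_inverse hp, Ring.inverse_inverse hq]

lemma arithMean_sub_harmMean [Algebra ℂ R] {p q : R} (hp : IsUnit p) (hq : IsUnit q)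
    (hpq : IsUnit (p + q)) :
    arithMean p q - harmMean p q =
      (2 : ℂ)⁻¹ • ((p - q) * Ring.inverse (p + q) * (p - q)) := by
  rw [arithMean, harmMean, ringInverse_ringInverse_add hp hq hpq]
  have h₁ := Ring.mul_inverse_cancel _ hpq
  have h₂ := Ring.inverse_mul_cancel _ hpq
  generalize Ring.inverse (p + q) = t at h₁ h₂ ⊢
  have e : (p - q) * t * (p - q) = (p + q) - (4 : ℂ) • (p * t * q) := by
    have e₁ : p - q = 2 * p - (p + q) := by noncomm_ring
    have e₂ : p - q = (p + q) - 2 * q := by noncomm_ring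
    calc (p - q) * t * (p - q) = (2 * p - (p + q)) * t * ((p + q) - 2 * q) := by
          rw [← e₁, ← e₂]
      _ = 2 * p * (t * (p + q)) - 4 * (p * t * q) - ((p + q) * t) * (p + q)
            + 2 * (((p + q) * t) * q) := by noncomm_ring
      _ = (p + q) - 4 * (p * t * q) := by rw [h₁, h₂]; noncomm_ring
      _ = _ := by rw [ofNat_smul_eq_nsmul ℂ 4, nsmul_eq_mul]; rfl
  rw [e]
  module

lemma arithMean_self [Algebra ℂ R] (a : R) : arithMean a a = a := by
  unfold arithMean; module

lemma arithMean_one_add_sub_one [Algebra ℂ R] (a b : R) :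
    arithMean (1 + a) (1 + b) - 1 = arithMean a b := by
  unfold arithMean; module

lemma harmMean_eq_ringInverse_arithMean [Algebra ℂ R] {a b : R}
    (h : IsUnit (Ring.inverse a + Ring.inverse b)) :
    harmMean a b = Ring.inverse (arithMean (Ring.inverse a) (Ring.inverse b)) := by
  rw [harmMean, arithMean, ringInverse_smul (by norm_num) h, inv_inv]

lemma harmMean_self [Algebra ℂ R] {a : R} (ha : IsUnit a) : harmMean a a = a := by
  have h : Ring.inverse a + Ring.inverse a = (2 : ℂ) • Ring.inverse a := (two_smul ℂ _).symm
  rw [harmMean, h, ringInverse_smul two_ne_zero ha.ringInverse, Ring.inverse_inverse ha,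
    smul_inv_smul₀ two_ne_zero]

lemma cayleyMean_eq_harmMean_sub_one [Algebra ℂ R] {a b : R}
    (h : IsUnit (1 + cayleySum a b)) :
    cayleyMean a b = harmMean (1 + a) (1 + b) - 1 := by
  have e : 1 - cayleySum a b = 2 - (1 + cayleySum a b) := by
    rw [← one_add_one_eq_two]; abel
  rw [cayleyMean, e, sub_mul, Ring.mul_inverse_cancel _ h, one_add_cayleySum, harmMean, two_mul,
    two_smul]

end Algebra

section CStarAlgebra

variable {R : Type*} [CStarAlgebra R] [PartialOrder R] [StarOrderedRing R] {a b : R}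

lemma IsStrictlyPositive.one_add (ha : IsStrictlyPositive a) : IsStrictlyPositive (1 + a) :=
  ha.nonneg_add zero_le_one

lemma one_sub_cayleySum (ha : IsStrictlyPositive a) (hb : IsStrictlyPositive b) :
    1 - cayleySum a b = 1 + cayleySum (Ring.inverse a) (Ring.inverse b) := by
  rw [one_add_cayleySum,
    ringInverse_one_add_ringInverse ha.isUnit ha.one_add.isUnit ha.ringInverse.one_add.isUnit,
    ringInverse_one_add_ringInverse hb.isUnit hb.one_add.isUnit hb.ringInverse.one_add.isUnit,
    cayleySum]
  abel

lemma isStrictlyPositive_one_add_cayleySum (ha : IsStrictlyPositive a)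
    (hb : IsStrictlyPositive b) : IsStrictlyPositive (1 + cayleySum a b) := by
  rw [one_add_cayleySum]
  exact ha.one_add.ringInverse.add_nonneg hb.one_add.ringInverse.nonneg

lemma isStrictlyPositive_one_sub_cayleySum (ha : IsStrictlyPositive a)
    (hb : IsStrictlyPositive b) : IsStrictlyPositive (1 - cayleySum a b) := by
  rw [one_sub_cayleySum ha hb]
  exact isStrictlyPositive_one_add_cayleySum ha.ringInverse hb.ringInverse

lemma isStrictlyPositive_cayleyMean (ha : IsStrictlyPositive a) (hb : IsStrictlyPositive b) :
    IsStrictlyPositive (cayleyMean a b) := by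
  have h := isStrictlyPositive_one_add_cayleySum ha hb
  refine ((isStrictlyPositive_one_sub_cayleySum ha hb).commute_iff h.ringInverse).1 ?_
  have e : 1 - cayleySum a b = 2 - (1 + cayleySum a b) := by
    rw [← one_add_one_eq_two]; abel
  rw [e, Commute, SemiconjBy, sub_mul, mul_sub, Ring.mul_inverse_cancel _ h.isUnit,
    Ring.inverse_mul_cancel _ h.isUnit, two_mul, mul_two]

lemma ringInverse_cayleyMean (ha : IsStrictlyPositive a) (hb : IsStrictlyPositive b) :
    Ring.inverse (cayleyMean a b) = cayleyMean (Ring.inverse a) (Ring.inverse b) := by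
  have h := (isStrictlyPositive_one_add_cayleySum ha hb).isUnit
  have e := one_sub_cayleySum ha hb
  have e' : 1 - cayleySum (Ring.inverse a) (Ring.inverse b) = 1 + cayleySum a b := by
    rw [one_sub_cayleySum ha.ringInverse hb.ringInverse, Ring.inverse_inverse ha.isUnit,
      Ring.inverse_inverse hb.isUnit]
  rw [cayleyMean, cayleyMean, Ring.inverse_mul (Or.inr h.ringInverse), Ring.inverse_inverse h,
    e', e]

lemma IsStrictlyPositive.eq_zero_of_star_mul_mul_eq_zero {c x : R} (hc : IsStrictlyPositive c)
    (h : star x * c * x = 0) : x = 0 := by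
  have hs := hc.sqrt
  have e : star (CFC.sqrt c * x) * (CFC.sqrt c * x) = 0 := by
    rw [star_mul, (IsSelfAdjoint.of_nonneg hs.nonneg).star_eq, ← mul_assoc,
      mul_assoc (star x), CFC.sqrt_mul_sqrt_self c hc.nonneg, h]
  rwa [CStarRing.star_mul_self_eq_zero_iff, hs.isUnit.mul_right_eq_zero] at e

lemma isSelfAdjoint_sub_of_isStrictlyPositive (ha : IsStrictlyPositive a)
    (hb : IsStrictlyPositive b) : IsSelfAdjoint (a - b) :=
  (IsSelfAdjoint.of_nonneg ha.nonneg).sub (.of_nonneg hb.nonneg)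

open scoped ComplexOrder in
lemma harmMean_le_arithMean (ha : IsStrictlyPositive a) (hb : IsStrictlyPositive b) :
    harmMean a b ≤ arithMean a b := by
  have h := ha.add_nonneg hb.nonneg
  rw [← sub_nonneg, arithMean_sub_harmMean ha.isUnit hb.isUnit h.isUnit]
  refine smul_nonneg (by simp) ?_
  exact (isSelfAdjoint_sub_of_isStrictlyPositive ha hb).conjugate_nonneg h.ringInverse.nonneg

lemma harmMean_eq_arithMean_iff (ha : IsStrictlyPositive a) (hb : IsStrictlyPositive b) :
    harmMean a b = arithMean a b ↔ a = b := by
  refine ⟨fun e ↦ ?_, ?_⟩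
  · have h := ha.add_nonneg hb.nonneg
    have e' := arithMean_sub_harmMean ha.isUnit hb.isUnit h.isUnit
    rw [e, sub_self, eq_comm, smul_eq_zero_iff_right (by norm_num)] at e'
    refine sub_eq_zero.1 (h.ringInverse.eq_zero_of_star_mul_mul_eq_zero ?_)
    rwa [(isSelfAdjoint_sub_of_isStrictlyPositive ha hb).star_eq]
  · rintro rfl
    rw [harmMean_self ha.isUnit, arithMean_self]

lemma cayleyMean_le_arithMean (ha : IsStrictlyPositive a) (hb : IsStrictlyPositive b) :
    cayleyMean a b ≤ arithMean a b := by
  rw [cayleyMean_eq_harmMean_sub_one (isStrictlyPositive_one_add_cayleySum ha hb).isUnit,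
    ← arithMean_one_add_sub_one]
  exact sub_le_sub_right (harmMean_le_arithMean ha.one_add hb.one_add) 1

lemma cayleyMean_eq_arithMean_iff (ha : IsStrictlyPositive a) (hb : IsStrictlyPositive b) :
    cayleyMean a b = arithMean a b ↔ a = b := by
  rw [cayleyMean_eq_harmMean_sub_one (isStrictlyPositive_one_add_cayleySum ha hb).isUnit,
    ← arithMean_one_add_sub_one, sub_left_inj, harmMean_eq_arithMean_iff ha.one_add hb.one_add,
    add_right_inj]

lemma cayleyMean_eq_ringInverse (ha : IsStrictlyPositive a) (hb : IsStrictlyPositive b) :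
    cayleyMean a b = Ring.inverse (cayleyMean (Ring.inverse a) (Ring.inverse b)) := by
  rw [← ringInverse_cayleyMean ha hb,
    Ring.inverse_inverse (isStrictlyPositive_cayleyMean ha hb).isUnit]

lemma harmMean_le_cayleyMean (ha : IsStrictlyPositive a) (hb : IsStrictlyPositive b) :
    harmMean a b ≤ cayleyMean a b := by
  have h := ha.ringInverse.add_nonneg hb.ringInverse.nonneg
  rw [harmMean_eq_ringInverse_arithMean h.isUnit, cayleyMean_eq_ringInverse ha hb]
  exact CStarAlgebra.ringInverse_le_ringInverse
    (cayleyMean_le_arithMean ha.ringInverse hb.ringInverse)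
    (isStrictlyPositive_cayleyMean ha.ringInverse hb.ringInverse)

lemma harmMean_eq_cayleyMean_iff (ha : IsStrictlyPositive a) (hb : IsStrictlyPositive b) :
    harmMean a b = cayleyMean a b ↔ a = b := by
  refine ⟨fun e ↦ ?_, ?_⟩
  · have h := ha.ringInverse.add_nonneg hb.ringInverse.nonneg
    have hu : IsUnit (arithMean (Ring.inverse a) (Ring.inverse b)) :=
      h.isUnit.smul (Units.mk0 (2 : ℂ)⁻¹ (by norm_num))
    rw [harmMean_eq_ringInverse_arithMean h.isUnit] at e
    have e' := congrArg Ring.inverse e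
    rw [Ring.inverse_inverse hu, ringInverse_cayleyMean ha hb, eq_comm,
      cayleyMean_eq_arithMean_iff ha.ringInverse hb.ringInverse] at e'
    rw [← Ring.inverse_inverse ha.isUnit, e', Ring.inverse_inverse hb.isUnit]
  · rintro rfl
    rw [harmMean_self ha.isUnit, (cayleyMean_eq_arithMean_iff ha ha).2 rfl, arithMean_self]

end CStarAlgebra

/-- For invertible `A, B ∈ B⁺(H)`, with `W = (I+A)⁻¹ + (I+B)⁻¹ - I` the operator
`c₀(A,B) = (I-W)(I+W)⁻¹` is a well-defined element of `B⁺(H)`, and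
`h(A,B) = 2(A⁻¹ + B⁻¹)⁻¹ ≤ c₀(A,B) ≤ (A+B)/2`, with equality (anywhere in the chain)
iff `A = B`. -/
theorem harmonic_le_c0_le_arithmetic (A B : H →L[ℂ] H)
    (hA : A.IsPositive) (hB : B.IsPositive) (hAu : IsUnit A) (hBu : IsUnit B) :
    let W : H →L[ℂ] H := Ring.inverse (1 + A) + Ring.inverse (1 + B) - 1
    let c₀ : H →L[ℂ] H := (1 - W) * Ring.inverse (1 + W)
    let h : H →L[ℂ] H := (2 : ℂ) • Ring.inverse (Ring.inverse A + Ring.inverse B)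
    let am : H →L[ℂ] H := (2 : ℂ)⁻¹ • (A + B)
    IsSelfAdjoint W ∧ (W + 1).IsPositive ∧ (1 - W).IsPositive ∧ IsUnit (1 + W) ∧
    c₀.IsPositive ∧
    (c₀ - h).IsPositive ∧ (am - c₀).IsPositive ∧
    (h = c₀ ↔ A = B) ∧ (c₀ = am ↔ A = B) ∧ (h = am ↔ A = B) := by
  intro W c₀ h am
  have hA' : IsStrictlyPositive A := ⟨(nonneg_iff_isPositive A).2 hA, hAu⟩
  have hB' : IsStrictlyPositive B := ⟨(nonneg_iff_isPositive B).2 hB, hBu⟩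
  have hadd : IsStrictlyPositive (1 + W) := isStrictlyPositive_one_add_cayleySum hA' hB'
  have hW : IsSelfAdjoint W := by
    simpa using (IsSelfAdjoint.of_nonneg hadd.nonneg).sub (.one _)
  simp only [← nonneg_iff_isPositive, sub_nonneg (a := c₀), sub_nonneg (a := am)]
  refine ⟨hW, ?_, (isStrictlyPositive_one_sub_cayleySum hA' hB').nonneg, hadd.isUnit,
    (isStrictlyPositive_cayleyMean hA' hB').nonneg, harmMean_le_cayleyMean hA' hB',
    cayleyMean_le_arithMean hA' hB', harmMean_eq_cayleyMean_iff hA' hB',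
    cayleyMean_eq_arithMean_iff hA' hB', harmMean_eq_arithMean_iff hA' hB'⟩
  rw [add_comm]
  exact hadd.nonneg
end

section
/- Let z₁, z₂ ∈ (−1, 1) and define sequences (z₁⁽ⁿ⁾), (z₂⁽ⁿ⁾) by z₁⁽⁰⁾ = z₁, z₂⁽⁰⁾ = z₂, and for n ≥ 1: 1 + z₁⁽ⁿ⁾ = 2(1 + z₁⁽ⁿ⁻¹⁾)(1 + z₂⁽ⁿ⁻¹⁾)/(2 + z₁⁽ⁿ⁻¹⁾ + z₂⁽ⁿ⁻¹⁾) and 1 − z₂⁽ⁿ⁾ = 2(1 − z₁⁽ⁿ⁻¹⁾)(1 − z₂⁽ⁿ⁻¹⁾)/(2 − z₁⁽ⁿ⁻¹⁾ − z₂⁽ⁿ⁻¹⁾). Then both sequences are well defined, remain in (−1,1), and converge to the common limit w̃ = (√((1+z₁)(1+z₂)) − √((1−z₁)(1−z₂))) / (√((1+z₁)(1+z₂)) + √((1−z₁)(1−z₂))). -/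
open Filter

/-- If `g ^ 2 = x * y` with all three positive, then `g` is at most `|x - y|` away from `x`. -/
lemma abs_sub_le_of_sq_eq_mul {x y g : ℝ} (hx : 0 < x) (hg : 0 < g) (h : g ^ 2 = x * y) :
    |x - g| ≤ |x - y| := by
  have key : (x - g) * (x + g) = x * (x - y) := by linear_combination -h
  have habs : |x - g| * (x + g) = x * |x - y| := by
    rw [← abs_of_pos (add_pos hx hg), ← abs_mul, key, abs_mul, abs_of_pos hx]
  have hle : |x - g| * x ≤ |x - y| * x := by
    nlinarith [mul_nonneg (abs_nonneg (x - g)) hg.le]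
  exact le_of_mul_le_mul_right hle hx

lemma arithmetic_harmonic_pos {a b : ℕ → ℝ} (ha0 : 0 < a 0) (hb0 : 0 < b 0)
    (ha : ∀ n, a (n + 1) = (a n + b n) / 2)
    (hb : ∀ n, b (n + 1) = 2 * a n * b n / (a n + b n)) (n : ℕ) : 0 < a n ∧ 0 < b n := by
  induction n with
  | zero => exact ⟨ha0, hb0⟩
  | succ n ih =>
    obtain ⟨h1, h2⟩ := ih
    rw [ha, hb]
    constructor <;> positivity

/-- The arithmetic–harmonic mean iteration converges to the geometric mean. -/
lemma tendsto_arithmetic_harmonic {a b : ℕ → ℝ} (ha0 : 0 < a 0) (hb0 : 0 < b 0)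
    (ha : ∀ n, a (n + 1) = (a n + b n) / 2)
    (hb : ∀ n, b (n + 1) = 2 * a n * b n / (a n + b n)) :
    Tendsto a atTop (nhds (Real.sqrt (a 0 * b 0))) ∧
      Tendsto b atTop (nhds (Real.sqrt (a 0 * b 0))) := by
  have hpos := arithmetic_harmonic_pos ha0 hb0 ha hb
  have hg : 0 < Real.sqrt (a 0 * b 0) := Real.sqrt_pos.2 (mul_pos ha0 hb0)
  have hprod (n : ℕ) : Real.sqrt (a 0 * b 0) ^ 2 = a n * b n := by
    induction n with
    | zero => exact Real.sq_sqrt (mul_pos ha0 hb0).le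
    | succ n ih =>
      obtain ⟨h1, h2⟩ := hpos n
      rw [ih, ha, hb]
      field_simp
  have hdiff (n : ℕ) : |a n - b n| ≤ |a 0 - b 0| * (1 / 2) ^ n := by
    induction n with
    | zero => simp
    | succ n ih =>
      obtain ⟨h1, h2⟩ := hpos n
      have heq : a (n + 1) - b (n + 1) = (a n - b n) ^ 2 / (2 * (a n + b n)) := by
        rw [ha, hb]
        field_simp
        ring
      have hlt : |a n - b n| ≤ a n + b n := abs_le.2 ⟨by linarith, by linarith⟩
      have hstep : |a (n + 1) - b (n + 1)| ≤ |a n - b n| * (1 / 2) := by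
        rw [heq, abs_of_nonneg (by positivity), div_le_iff₀ (by positivity), ← sq_abs]
        nlinarith [mul_le_mul_of_nonneg_left hlt (abs_nonneg (a n - b n))]
      rw [pow_succ]
      linarith
  have hlim : Tendsto (fun n : ℕ => |a 0 - b 0| * (1 / 2) ^ n) atTop (nhds 0) := by
    simpa using (tendsto_pow_atTop_nhds_zero_of_lt_one (r := (1 / 2 : ℝ))
      (by norm_num) (by norm_num)).const_mul |a 0 - b 0|
  constructor
  · refine tendsto_iff_dist_tendsto_zero.2 (squeeze_zero (fun _ => dist_nonneg) (fun n => ?_) hlim)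
    rw [Real.dist_eq]
    exact (abs_sub_le_of_sq_eq_mul (hpos n).1 hg (hprod n)).trans (hdiff n)
  · refine tendsto_iff_dist_tendsto_zero.2 (squeeze_zero (fun _ => dist_nonneg) (fun n => ?_) hlim)
    rw [Real.dist_eq]
    refine (abs_sub_le_of_sq_eq_mul (hpos n).2 hg ((hprod n).trans (mul_comm _ _))).trans ?_
    rw [abs_sub_comm]
    exact hdiff n

/-- The harmonic mean of two numbers in `(0, 2)` lies in `(0, 2)`. -/
lemma harmonic_mean_mem_Ioo {p q : ℝ} (hp : p ∈ Set.Ioo (0 : ℝ) 2) (hq : q ∈ Set.Ioo (0 : ℝ) 2) :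
    2 * p * q / (p + q) ∈ Set.Ioo (0 : ℝ) 2 := by
  obtain ⟨hp0, hp2⟩ := hp
  obtain ⟨hq0, hq2⟩ := hq
  refine ⟨by positivity, ?_⟩
  rw [div_lt_iff₀ (by positivity)]
  nlinarith [mul_pos hp0 (sub_pos.2 hq2), mul_pos hq0 (sub_pos.2 hp2)]

/-- The Cayley transform `x ↦ (1 - x) / (1 + x)` is its own inverse. -/
lemma cayley_cayley {x : ℝ} (hx : 1 + x ≠ 0) :
    (1 - (1 - x) / (1 + x)) / (1 + (1 - x) / (1 + x)) = x := by
  have h : 1 + (1 - x) / (1 + x) = 2 / (1 + x) := by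
    field_simp
    ring
  rw [h]
  field_simp
  ring

/-- Convergence can be read off from the Cayley-transformed sequence. -/
lemma tendsto_of_tendsto_cayley {u : ℕ → ℝ} {g : ℝ} (hu : ∀ n, 1 + u n ≠ 0) (hg : 1 + g ≠ 0)
    (h : Tendsto (fun n => (1 - u n) / (1 + u n)) atTop (nhds g)) :
    Tendsto u atTop (nhds ((1 - g) / (1 + g))) :=
  ((h.const_sub 1).div (h.const_add 1) hg).congr fun n => cayley_cayley (hu n)

/-- The Cayley-transformed arithmetic–harmonic iteration: starting from `z₁, z₂ ∈ (-1,1)`,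
the sequences defined by
`1 + z₁⁽ⁿ⁾ = 2(1 + z₁⁽ⁿ⁻¹⁾)(1 + z₂⁽ⁿ⁻¹⁾)/(2 + z₁⁽ⁿ⁻¹⁾ + z₂⁽ⁿ⁻¹⁾)` and
`1 - z₂⁽ⁿ⁾ = 2(1 - z₁⁽ⁿ⁻¹⁾)(1 - z₂⁽ⁿ⁻¹⁾)/(2 - z₁⁽ⁿ⁻¹⁾ - z₂⁽ⁿ⁻¹⁾)`
remain in `(-1,1)` and converge to the common limit
`w = (√((1+z₁)(1+z₂)) - √((1-z₁)(1-z₂)))/(√((1+z₁)(1+z₂)) + √((1-z₁)(1-z₂)))`. -/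
theorem cayley_arithmetic_harmonic_iteration (z₁ z₂ : ℝ)
    (h₁ : z₁ ∈ Set.Ioo (-1 : ℝ) 1) (h₂ : z₂ ∈ Set.Ioo (-1 : ℝ) 1)
    (u v : ℕ → ℝ) (hu0 : u 0 = z₁) (hv0 : v 0 = z₂)
    (hu : ∀ n, 1 + u (n + 1) = 2 * (1 + u n) * (1 + v n) / (2 + u n + v n))
    (hv : ∀ n, 1 - v (n + 1) = 2 * (1 - u n) * (1 - v n) / (2 - u n - v n)) :
    (∀ n, u n ∈ Set.Ioo (-1 : ℝ) 1 ∧ v n ∈ Set.Ioo (-1 : ℝ) 1) ∧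
    Tendsto u atTop (nhds
      ((Real.sqrt ((1 + z₁) * (1 + z₂)) - Real.sqrt ((1 - z₁) * (1 - z₂))) /
        (Real.sqrt ((1 + z₁) * (1 + z₂)) + Real.sqrt ((1 - z₁) * (1 - z₂))))) ∧
    Tendsto v atTop (nhds
      ((Real.sqrt ((1 + z₁) * (1 + z₂)) - Real.sqrt ((1 - z₁) * (1 - z₂))) /
        (Real.sqrt ((1 + z₁) * (1 + z₂)) + Real.sqrt ((1 - z₁) * (1 - z₂))))) := by
  have hmem (n : ℕ) : u n ∈ Set.Ioo (-1 : ℝ) 1 ∧ v n ∈ Set.Ioo (-1 : ℝ) 1 := by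
    induction n with
    | zero => exact ⟨hu0 ▸ h₁, hv0 ▸ h₂⟩
    | succ n ih =>
      obtain ⟨⟨hul, hur⟩, hvl, hvr⟩ := ih
      have hp := harmonic_mean_mem_Ioo (p := 1 + u n) (q := 1 + v n)
        ⟨by linarith, by linarith⟩ ⟨by linarith, by linarith⟩
      have hq := harmonic_mean_mem_Ioo (p := 1 - u n) (q := 1 - v n)
        ⟨by linarith, by linarith⟩ ⟨by linarith, by linarith⟩
      rw [show 1 + u n + (1 + v n) = 2 + u n + v n by ring, ← hu] at hp
      rw [show 1 - u n + (1 - v n) = 2 - u n - v n by ring, ← hv] at hq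
      exact ⟨⟨by linarith [hp.1], by linarith [hp.2]⟩, by linarith [hq.2], by linarith [hq.1]⟩
  have hup (n : ℕ) : 0 < 1 + u n := by linarith [(hmem n).1.1]
  have hum (n : ℕ) : 0 < 1 - u n := by linarith [(hmem n).1.2]
  have hvp (n : ℕ) : 0 < 1 + v n := by linarith [(hmem n).2.1]
  have hvm (n : ℕ) : 0 < 1 - v n := by linarith [(hmem n).2.2]
  have hlim := tendsto_arithmetic_harmonic
    (a := fun n => (1 - u n) / (1 + u n)) (b := fun n => (1 - v n) / (1 + v n))
    (div_pos (hum 0) (hup 0)) (div_pos (hvm 0) (hvp 0))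
    (fun n => by
      have h1 := hup n
      have h2 := hvp n
      have h3 : 0 < 2 + u n + v n := by linarith
      have h4 : 1 - u (n + 1) = 2 - 2 * (1 + u n) * (1 + v n) / (2 + u n + v n) := by
        linarith [hu n]
      simp only [h4, hu n]
      field_simp
      ring)
    (fun n => by
      have h1 := hup n
      have h2 := hvp n
      have h3 := hum n
      have h4 := hvm n
      have h5 : 0 < 2 - u n - v n := by linarith
      have h6 : 1 + v (n + 1) = 2 - 2 * (1 - u n) * (1 - v n) / (2 - u n - v n) := by
        linarith [hv n]
      have h7 : 1 + v (n + 1) =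
          ((1 - u n) * (1 + v n) + (1 - v n) * (1 + u n)) / (2 - u n - v n) := by
        rw [h6]
        field_simp
        ring
      simp only [h7, hv n]
      field_simp)
  simp only [hu0, hv0] at hlim
  have hup0 : 0 < 1 + z₁ := by linarith [h₁.1]
  have hvp0 : 0 < 1 + z₂ := by linarith [h₂.1]
  have hT : 0 < Real.sqrt ((1 + z₁) * (1 + z₂)) := Real.sqrt_pos.2 (mul_pos hup0 hvp0)
  have hg : Real.sqrt ((1 - z₁) / (1 + z₁) * ((1 - z₂) / (1 + z₂))) =
      Real.sqrt ((1 - z₁) * (1 - z₂)) / Real.sqrt ((1 + z₁) * (1 + z₂)) := by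
    rw [div_mul_div_comm, Real.sqrt_div' _ (mul_pos hup0 hvp0).le]
  rw [hg] at hlim
  have hlimit (S T : ℝ) (hT : T ≠ 0) : (1 - S / T) / (1 + S / T) = (T - S) / (T + S) := by
    rw [one_sub_div hT, one_add_div hT, div_div_div_cancel_right₀ hT]
  rw [← hlimit _ _ hT.ne']
  exact ⟨hmem, tendsto_of_tendsto_cayley (fun n => (hup n).ne') (by positivity) hlim.1,
    tendsto_of_tendsto_cayley (fun n => (hvp n).ne') (by positivity) hlim.2⟩
end
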